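/- Let p ≥ 2 and n ≥ 1 be natural numbers. The number of distinct primes l with l > p that divide p^n − 1 is strictly less than n. -/

import Mathlib

/-- For `p ≥ 2` and `n ≥ 1`, the number of distinct primes `l > p` dividing `p^n - 1`
is strictly less than `n`. -/
theorem statement_16 (p n : ℕ) (hp : 2 ≤ p) (hn : 1 ≤ n) :
    ((p ^ n - 1).primeFactors.filter (fun l => p < l)).card < n := by
  have h1 : 1 < p ^ n := Nat.one_lt_pow (by omega) (by omega)
  have h2 : p ^ ((p ^ n - 1).primeFactors.filter (fun l => p < l)).card
      ≤ ∏ l ∈ (p ^ n - 1).primeFactors.filter (fun l => p < l), l :=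
    Finset.pow_card_le_prod _ _ _ (fun l hl => (Finset.mem_filter.mp hl).2.le)
  have h3 : (∏ l ∈ (p ^ n - 1).primeFactors.filter (fun l => p < l), l) ∣ p ^ n - 1 :=
    (Finset.prod_dvd_prod_of_subset _ _ _ (Finset.filter_subset _ _)).trans
      (Nat.prod_primeFactors_dvd _)
  have h4 := Nat.le_of_dvd (by omega) h3
  exact (Nat.pow_lt_pow_iff_right (a := p) (by omega)).mp (by omega)
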